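/- Let F be a field of characteristic 0 and let μ ∈ F be a primitive p-th root of unity. Then for all W, P ∈ F with W^p ≠ P^p, and every integer m ≥ 1: (1/p) · ∑_{t=0}^{p−1} (μ^t·W − P)^{−m} = ∑_{n=⌈m/p⌉}^{m} C(n,m) · P^{n·p − m} · (W^p − P^p)^{−n}, where the rational numbers C(n,m) are mapped into F via the canonical ring homomorphism ℚ → F (note μ^t·W − P ≠ 0 for all t since W^p ≠ P^p; the convention 0^0 = 1 is used for the factor P^{np−m}). This computes the Dwork operator U_p applied to (X − P)^{−m}: (U_p ξ)(W^p) = (1/p)·∑_{Z^p = W^p} ξ(Z) for ξ(X) = (X − P)^{−m}. -/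

import Mathlib

open Finset

/-- The rational numbers `C(n,m) = (m/(np)) ∑ ∏_{k=1}^n (p choose i_k)`, the sum ranging over
all `n`-tuples `(i_1, …, i_n)` with `1 ≤ i_k ≤ p` and `i_1 + ⋯ + i_n = m`. -/
noncomputable def dworkC (p n m : ℕ) : ℚ :=
  (m : ℚ) / ((n : ℚ) * (p : ℚ)) *
    ∑ i ∈ (Fintype.piFinset fun _ : Fin n => Finset.Icc 1 p).filter
        (fun i => ∑ k, i k = m),
      ∏ k, (p.choose (i k) : ℚ)

/-- Logarithmic derivative of `∏ (X - a_t)` expanded at the origin. -/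
theorem prod_X_sub_C_mul_sum_mk_inv {F ι : Type*} [Field F] (s : Finset ι) (a : ι → F)
    (ha : ∀ t ∈ s, a t ≠ 0) :
    ((∏ t ∈ s, (Polynomial.X - Polynomial.C (a t)) : Polynomial F) : PowerSeries F) *
        ∑ t ∈ s, PowerSeries.mk (fun k => (a t)⁻¹ ^ (k + 1)) =
      -((Polynomial.derivative (∏ t ∈ s, (Polynomial.X - Polynomial.C (a t))) : Polynomial F) :
        PowerSeries F) := by
  classical
  have key : ∀ t ∈ s, ((PowerSeries.X : PowerSeries F) - PowerSeries.C (a t)) *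
      PowerSeries.mk (fun k => (a t)⁻¹ ^ (k + 1)) = -1 := by
    intro t ht
    have := PowerSeries.invUnitsSub_mul_sub (Units.mk0 (a t) (ha t ht))
    have hmk : PowerSeries.invUnitsSub (Units.mk0 (a t) (ha t ht)) =
        PowerSeries.mk (fun k => (a t)⁻¹ ^ (k + 1)) := by
      ext k
      simp [divp]
    rw [hmk, Units.val_mk0] at this
    linear_combination -this
  rw [Polynomial.derivative_prod_finset, Finset.mul_sum]
  simp only [Polynomial.derivative_X_sub_C, mul_one]
  rw [← Polynomial.coeToPowerSeries.ringHom_apply, ← Polynomial.coeToPowerSeries.ringHom_apply,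
    map_sum, ← Finset.sum_neg_distrib]
  refine Finset.sum_congr rfl fun t ht => ?_
  rw [← Finset.prod_erase_mul _ _ ht, map_mul, mul_assoc]
  simp only [map_sub, Polynomial.coeToPowerSeries.ringHom_apply, Polynomial.coe_X,
    Polynomial.coe_C]
  rw [key t ht, mul_neg_one]

/-- If `(q - G) S = G'` with `q ≠ 0` and `G(0) = 0`, then the coefficients of `S` are those of
`∑ (G ^ n)' / (n q ^ n)`. -/
theorem coeff_of_sub_mul_eq_derivative {F : Type*} [Field F] [CharZero F] {q : F} (hq : q ≠ 0)
    {G S : PowerSeries F} (hG : PowerSeries.X ∣ G)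
    (h : (PowerSeries.C q - G) * S = PowerSeries.derivative F G) (m : ℕ) :
    PowerSeries.coeff m S = ∑ n ∈ Finset.range (m + 1),
      q⁻¹ ^ (n + 1) * (((m + 1 : ℕ) : F) / ((n + 1 : ℕ) : F)) *
        PowerSeries.coeff (m + 1) (G ^ (n + 1)) := by
  have hC : PowerSeries.C q * PowerSeries.C q⁻¹ = 1 := by
    rw [← map_mul, mul_inv_cancel₀ hq, map_one]
  set H := PowerSeries.C q⁻¹ * G with hH
  set R := PowerSeries.C q⁻¹ * PowerSeries.derivative F G *
    ∑ n ∈ Finset.range (m + 1), H ^ n with hR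
  have hD : PowerSeries.C q - G = PowerSeries.C q * (1 - H) := by
    rw [hH]; linear_combination G * hC
  have hDR : (PowerSeries.C q - G) * (S - R) =
      PowerSeries.derivative F G * H ^ (m + 1) := by
    have hg := mul_neg_geom_sum H (m + 1)
    rw [mul_sub, h, hR, hD]
    linear_combination (-(PowerSeries.derivative F G) * (1 - H ^ (m + 1))) * hC -
      PowerSeries.C q * PowerSeries.C q⁻¹ * PowerSeries.derivative F G * hg
  have hu : IsUnit (PowerSeries.C q - G) := by
    rw [PowerSeries.isUnit_iff_constantCoeff]
    rw [PowerSeries.X_dvd_iff] at hG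
    simpa [hG] using hq
  have hdvd : (PowerSeries.X : PowerSeries F) ^ (m + 1) ∣ S - R := by
    rw [← hu.dvd_mul_left, hDR]
    exact Dvd.dvd.mul_left (pow_dvd_pow_of_dvd (hG.mul_left _) _) _
  have hcoeff := PowerSeries.X_pow_dvd_iff.1 hdvd m (Nat.lt_succ_self m)
  rw [map_sub, sub_eq_zero] at hcoeff
  rw [hcoeff, hR, Finset.mul_sum, map_sum]
  refine Finset.sum_congr rfl fun n _ => ?_
  have hn : ((n + 1 : ℕ) : F) ≠ 0 := Nat.cast_ne_zero.2 n.succ_ne_zero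
  have hder : PowerSeries.coeff m (PowerSeries.derivative F (G ^ (n + 1))) =
      ((n + 1 : ℕ) : F) * PowerSeries.coeff m (G ^ n * PowerSeries.derivative F G) := by
    rw [Derivation.leibniz_pow, Nat.add_sub_cancel, map_nsmul, nsmul_eq_mul, smul_eq_mul]
  rw [PowerSeries.coeff_derivative] at hder
  have hre : PowerSeries.C q⁻¹ * PowerSeries.derivative F G * H ^ n =
      PowerSeries.C (q⁻¹ ^ (n + 1)) * (G ^ n * PowerSeries.derivative F G) := by
    rw [hH, map_pow]; ring
  rw [hre, PowerSeries.coeff_C_mul, mul_assoc]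
  congr 1
  rw [div_mul_eq_mul_div, eq_div_iff hn]
  push_cast at hder ⊢
  linear_combination -hder

/-- The coefficients of the powers of `(X + P) ^ p - P ^ p`. -/
theorem coeff_X_add_C_pow_sub_pow {F : Type*} [Field F] (P : F) (p n m : ℕ) :
    (((Polynomial.X + Polynomial.C P) ^ p - Polynomial.C (P ^ p)) ^ n : Polynomial F).coeff m =
      (∑ i ∈ (Fintype.piFinset fun _ : Fin n => Finset.Icc 1 p).filter (fun i => ∑ k, i k = m),
        ∏ k, (p.choose (i k) : F)) * P ^ (n * p - m) := by
  have hG : ((Polynomial.X + Polynomial.C P) ^ p - Polynomial.C (P ^ p) : Polynomial F) =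
      ∑ i ∈ Finset.Icc 1 p,
        Polynomial.C ((p.choose i : F) * P ^ (p - i)) * Polynomial.X ^ i := by
    rw [add_pow, Finset.range_eq_Ico, Finset.sum_eq_sum_Ico_succ_bot (Nat.succ_pos p)]
    simp only [pow_zero, one_mul, Nat.sub_zero, Nat.choose_zero_right, Nat.cast_one, mul_one,
      map_pow, add_sub_cancel_left]
    refine Finset.sum_congr (by ext; simp) fun i _ => ?_
    simp only [map_mul, map_pow, map_natCast]
    ring
  have hpow (g : Polynomial F) : g ^ n = ∏ _k : Fin n, g := by simp
  rw [hG, hpow, Finset.prod_univ_sum, Polynomial.finsetSum_coeff, Finset.sum_mul,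
    Finset.sum_filter]
  refine Finset.sum_congr rfl fun i hi => ?_
  rw [Finset.prod_mul_distrib, ← map_prod, Finset.prod_pow_eq_pow_sum,
    Polynomial.coeff_C_mul_X_pow, Finset.prod_mul_distrib, Finset.prod_pow_eq_pow_sum]
  have hsum : ∑ k, (p - i k) + ∑ k, i k = n * p := by
    rw [← Finset.sum_add_distrib, Finset.sum_congr rfl (g := fun _ => p)]
    · simp
    · intro k _
      have := Finset.mem_Icc.1 (Fintype.mem_piFinset.1 hi k)
      omega
  by_cases hm : m = ∑ k, i k
  · rw [if_pos hm, if_pos hm.symm, hm, ← hsum, Nat.add_sub_cancel]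
  · rw [if_neg hm, if_neg (Ne.symm hm)]

theorem dworkC_eq_zero_of_mul_lt {p n m : ℕ} (h : n * p < m) : dworkC p n m = 0 := by
  rw [dworkC, Finset.filter_eq_empty_iff.2, Finset.sum_empty, mul_zero]
  intro i hi hsum
  have : ∑ k, i k ≤ ∑ _k : Fin n, p :=
    Finset.sum_le_sum fun k _ => (Finset.mem_Icc.1 (Fintype.mem_piFinset.1 hi k)).2
  simp at this
  omega

/-- The action of the Dwork operator `U_p` on `(X - P)^{-m}`: if `μ` is a primitive `p`-th root
of unity in a field `F` of characteristic zero and `W^p ≠ P^p`, then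
`(1/p) ∑_{t=0}^{p-1} (μ^t W - P)^{-m} = ∑_{n=⌈m/p⌉}^{m} C(n,m) P^{np-m} (W^p - P^p)^{-n}`. -/
theorem up_inv_pow_sub_eq_sum_dworkC
    (p : ℕ) [Fact p.Prime] (F : Type*) [Field F] [CharZero F]
    (μ : F) (hμ : IsPrimitiveRoot μ p)
    (W P : F) (hWP : W ^ p ≠ P ^ p) (m : ℕ) (hm : 1 ≤ m) :
    (1 / (p : F)) * ∑ t ∈ Finset.range p, (μ ^ t * W - P) ^ (-(m : ℤ)) =
      ∑ n ∈ Finset.Icc (m ⌈/⌉ p) m,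
        ((dworkC p n m : ℚ) : F) * P ^ (n * p - m) * (W ^ p - P ^ p) ^ (-(n : ℤ)) := by
  have hp : 0 < p := (Fact.out : p.Prime).pos
  have ha : ∀ t ∈ Finset.range p, μ ^ t * W - P ≠ 0 := by
    intro t _ h
    apply hWP
    rw [← sub_eq_zero.1 h, mul_pow, ← pow_mul, mul_comm t, pow_mul, hμ.pow_eq_one, one_pow,
      one_mul]
  obtain ⟨m, rfl⟩ : ∃ k, m = k + 1 := ⟨m - 1, by omega⟩
  set g : Polynomial F := (Polynomial.X + Polynomial.C P) ^ p - Polynomial.C (P ^ p) with hg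
  have hprod : g - Polynomial.C (W ^ p - P ^ p) =
      ∏ t ∈ Finset.range p, (Polynomial.X - Polynomial.C (μ ^ t * W - P)) := by
    have := congrArg (fun f => Polynomial.comp f (Polynomial.X + Polynomial.C P))
      (X_pow_sub_C_eq_prod hμ hp (rfl : W ^ p = W ^ p))
    simp only [Polynomial.sub_comp, Polynomial.pow_comp, Polynomial.X_comp, Polynomial.C_comp,
      Polynomial.prod_comp] at this
    rw [hg, Polynomial.C_sub, sub_sub_sub_cancel_right, this]
    refine Finset.prod_congr rfl fun t _ => ?_
    rw [Polynomial.C_sub]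
    ring
  have hlog := prod_X_sub_C_mul_sum_mk_inv (Finset.range p) (fun t => μ ^ t * W - P) ha
  rw [← hprod, Polynomial.derivative_sub, Polynomial.derivative_C, sub_zero,
    ← PowerSeries.derivative_coe, Polynomial.coe_sub, Polynomial.coe_C] at hlog
  have hX : (PowerSeries.X : PowerSeries F) ∣ (g : PowerSeries F) := by
    rw [PowerSeries.X_dvd_iff, ← PowerSeries.coeff_zero_eq_constantCoeff_apply,
      Polynomial.coeff_coe, Polynomial.coeff_zero_eq_eval_zero]
    simp [hg]
  have hS := coeff_of_sub_mul_eq_derivative (sub_ne_zero.2 hWP) hX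
    (S := ∑ t ∈ Finset.range p, PowerSeries.mk fun k => (μ ^ t * W - P)⁻¹ ^ (k + 1))
    (by linear_combination -hlog) m
  simp only [map_sum, PowerSeries.coeff_mk] at hS
  have hsub : Finset.Icc ((m + 1) ⌈/⌉ p) (m + 1) ⊆ Finset.Icc 1 (m + 1) := by
    refine Finset.Icc_subset_Icc_left (Nat.one_le_iff_ne_zero.2 fun h => ?_)
    have := (ceilDiv_le_iff_le_mul hp).1 h.le
    simp at this
  rw [Finset.sum_subset hsub]
  · have hIcc : Finset.Icc 1 (m + 1) = Finset.Ico 1 (m + 1 + 1) := by ext; simp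
    rw [hIcc, Finset.sum_Ico_eq_sum_range, Nat.add_sub_cancel]
    simp only [zpow_neg, zpow_natCast, ← inv_pow]
    rw [hS, Finset.mul_sum]
    refine Finset.sum_congr rfl fun n _ => ?_
    rw [← Polynomial.coe_pow, Polynomial.coeff_coe, hg, coeff_X_add_C_pow_sub_pow, dworkC,
      add_comm 1 n]
    push_cast
    field_simp
  · intro n hn hn'
    rw [dworkC_eq_zero_of_mul_lt, Rat.cast_zero, zero_mul, zero_mul]
    by_contra! hle
    refine hn' (Finset.mem_Icc.2 ⟨(ceilDiv_le_iff_le_mul hp).2 (by rwa [mul_comm]), ?_⟩)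
    exact (Finset.mem_Icc.1 hn).2
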